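/- arXiv:1607.06136 — 2 statements merged into one kernel-verified Lean document; each statement's English description precedes it below -/
import Mathlib

section
/- Let Δ₁ and Δ₂ be disjoint non-vertical triangles in ℝ³. Then it is not the case that both Δ₁ ≺ Δ₂ and Δ₂ ≺ Δ₁; moreover Δ₁ ≺ Δ₁ never holds. That is, the depth relation on a family of pairwise disjoint non-vertical triangles has no self-loops and no 2-cycles, so every cycle in the depth relation has length at least 3. -/
/-- A set in `ℝ³` is a non-vertical triangle if it is the convex hull of three affinely
independent points whose spanning plane is not parallel to the `z`-axis. -/
def IsNonVerticalTriangle (s : Set (Fin 3 → ℝ)) : Prop :=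
  ∃ a b c : Fin 3 → ℝ, AffineIndependent ℝ ![a, b, c] ∧
    s = convexHull ℝ {a, b, c} ∧
    (![0, 0, 1] : Fin 3 → ℝ) ∉ (affineSpan ℝ ({a, b, c} : Set (Fin 3 → ℝ))).direction

/-- The depth relation: `o₁ ≺ o₂` if some vertical line meets both sets, with the
intersection with `o₁` lower (in `z`-coordinate) than the intersection with `o₂`. -/
def Below (o₁ o₂ : Set (Fin 3 → ℝ)) : Prop :=
  ∃ p ∈ o₁, ∃ q ∈ o₂, p 0 = q 0 ∧ p 1 = q 1 ∧ p 2 < q 2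

/-- A convex set disjoint from another convex set cannot lie both below and above it. -/
theorem not_below_and_below_of_convex {s t : Set (Fin 3 → ℝ)} (hs : Convex ℝ s)
    (ht : Convex ℝ t) (hdisj : Disjoint s t) : ¬ (Below s t ∧ Below t s) := by
  rintro ⟨⟨p, hp, q, hq, h0, h1, h2⟩, q', hq', p', hp', h0', h1', h2'⟩
  have hd : 0 < (q 2 - p 2) + (p' 2 - q' 2) := by linarith
  set a := (p' 2 - q' 2) / ((q 2 - p 2) + (p' 2 - q' 2)) with ha_def
  set b := (q 2 - p 2) / ((q 2 - p 2) + (p' 2 - q' 2)) with hb_def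
  have ha : 0 ≤ a := div_nonneg (by linarith) hd.le
  have hb : 0 ≤ b := div_nonneg (by linarith) hd.le
  have hab : a + b = 1 := by
    rw [ha_def, hb_def]
    field_simp
    ring
  have heq : a • p + b • p' = a • q + b • q' := by
    ext i
    fin_cases i
    · simp [h0, h0']
    · simp [h1, h1']
    · simp only [ha_def, hb_def, Fin.reduceFinMk, Pi.add_apply, Pi.smul_apply, smul_eq_mul]
      field_simp
      ring
  exact Set.disjoint_left.mp hdisj (hs hp hp' ha hb hab) (heq ▸ ht hq hq' ha hb hab)

theorem IsNonVerticalTriangle.convex {s : Set (Fin 3 → ℝ)} (hs : IsNonVerticalTriangle s) :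
    Convex ℝ s := by
  obtain ⟨a, b, c, -, rfl, -⟩ := hs
  exact convex_convexHull ℝ _

theorem IsNonVerticalTriangle.not_below_self {s : Set (Fin 3 → ℝ)}
    (hs : IsNonVerticalTriangle s) : ¬ Below s s := by
  obtain ⟨a, b, c, -, rfl, hv⟩ := hs
  rintro ⟨p, hp, q, hq, h0, h1, h2⟩
  apply hv
  have hmem : q - p ∈ (affineSpan ℝ ({a, b, c} : Set (Fin 3 → ℝ))).direction :=
    AffineSubspace.vsub_mem_direction (convexHull_subset_affineSpan _ hq)
      (convexHull_subset_affineSpan _ hp)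
  have hne : q 2 - p 2 ≠ 0 := (sub_pos.mpr h2).ne'
  have heq : (![0, 0, 1] : Fin 3 → ℝ) = (q 2 - p 2)⁻¹ • (q - p) := by
    ext i
    fin_cases i
    · simp [h0]
    · simp [h1]
    · simp [hne]
  rw [heq]
  exact Submodule.smul_mem _ _ hmem


/-- For disjoint non-vertical triangles `Δ₁, Δ₂` one never has both
`Δ₁ ≺ Δ₂` and `Δ₂ ≺ Δ₁`; moreover `Δ₁ ≺ Δ₁` never holds. Hence the depth relation on a
family of pairwise disjoint non-vertical triangles has no self-loops and no 2-cycles, so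
every cycle has length at least 3. -/
theorem depth_no_self_loops_no_two_cycles
    (Δ₁ Δ₂ : Set (Fin 3 → ℝ))
    (h₁ : IsNonVerticalTriangle Δ₁) (h₂ : IsNonVerticalTriangle Δ₂)
    (hdisj : Disjoint Δ₁ Δ₂) :
    ¬ (Below Δ₁ Δ₂ ∧ Below Δ₂ Δ₁) ∧ ¬ Below Δ₁ Δ₁ := by
  exact ⟨not_below_and_below_of_convex h₁.convex h₂.convex hdisj, h₁.not_below_self⟩
end

section
/- There exists an absolute constant C such that for every nonzero polynomial f ∈ ℝ[x,y,z] of degree at most D (D ≥ 1), the number of connected components of ℝ³ \ Z(f) is at most C·D³. -/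
/-- The real zero set of a polynomial `f ∈ ℝ[x,y,z]`. -/
def ZeroSet (f : MvPolynomial (Fin 3) ℝ) : Set (Fin 3 → ℝ) :=
  {p | MvPolynomial.eval p f = 0}

namespace MvPolynomial

variable {σ : Type*}

theorem hasDerivAt_eval_update [DecidableEq σ] (p : MvPolynomial σ ℝ) (x : σ → ℝ) (i : σ)
    (t : ℝ) :
    HasDerivAt (fun s => eval (Function.update x i s) p)
      (eval (Function.update x i t) (pderiv i p)) t := by
  induction p using MvPolynomial.induction_on with
  | C a => simpa using hasDerivAt_const t a
  | add p q hp hq =>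
    simp only [map_add]
    exact hp.add hq
  | mul_X p j hp =>
    have hX : HasDerivAt (fun s => Function.update x i s j) ((Pi.single i 1 : σ → ℝ) j) t := by
      rcases eq_or_ne j i with rfl | hji
      · simp only [Function.update_self, Pi.single_eq_same]
        exact hasDerivAt_id t
      · simpa [hji] using hasDerivAt_const t (x j)
    have h := hp.mul hX
    have hs : eval (Function.update x i t) ((Pi.single i 1 : σ → MvPolynomial σ ℝ) j) =
        (Pi.single i 1 : σ → ℝ) j := by
      rcases eq_or_ne j i with rfl | hji <;> simp [*]
    simp only [map_mul, eval_X, pderiv_mul, map_add, pderiv_X, hs]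
    exact h

theorem totalDegree_pderiv_le {R : Type*} [CommSemiring R] (p : MvPolynomial σ R) (i : σ) :
    (pderiv i p).totalDegree ≤ p.totalDegree := by
  classical
  refine Finset.sup_le fun m hm => ?_
  rw [mem_support_iff, coeff_pderiv] at hm
  have h : m + Finsupp.single i 1 ∈ p.support :=
    mem_support_iff.2 fun h0 => hm (by rw [h0, zero_mul])
  refine le_trans ?_ (le_totalDegree h)
  rw [Finsupp.sum_add_index' (fun _ => rfl) (fun _ _ _ => rfl)]
  exact Nat.le_add_right _ _

theorem exists_abs_eval_le [Fintype σ] (p : MvPolynomial σ ℝ) {d : ℕ} (hd : p.totalDegree ≤ d) :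
    ∃ A : ℝ, 0 ≤ A ∧ ∀ x : σ → ℝ, |eval x p| ≤ A * (max 1 ‖x‖) ^ d := by
  refine ⟨∑ m ∈ p.support, |coeff m p|, by positivity, fun x => ?_⟩
  rw [eval_eq', Finset.sum_mul]
  refine (Finset.abs_sum_le_sum_abs _ _).trans (Finset.sum_le_sum fun m hm => ?_)
  rw [abs_mul]
  refine mul_le_mul_of_nonneg_left ?_ (abs_nonneg _)
  rw [Finset.abs_prod]
  calc ∏ i, |x i ^ m i| ≤ ∏ i, (max 1 ‖x‖) ^ m i := by
        refine Finset.prod_le_prod (fun _ _ => abs_nonneg _) fun i _ => ?_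
        rw [abs_pow]
        exact pow_le_pow_left₀ (abs_nonneg _) ((norm_le_pi_norm x i).trans (le_max_right _ _)) _
    _ = (max 1 ‖x‖) ^ (∑ i, m i) := Finset.prod_pow_eq_pow_sum _ _ _
    _ ≤ (max 1 ‖x‖) ^ d := by
        refine pow_le_pow_right₀ (le_max_left _ _) (le_trans ?_ hd)
        have := le_totalDegree hm
        rwa [Finsupp.sum_fintype _ _ fun _ => rfl] at this

theorem exists_eval_eq_pi_single {K ι : Type*} [Field K] [Fintype ι] [DecidableEq ι]
    {v : ι → σ → K} (hv : Function.Injective v) (j : ι) :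
    ∃ p : MvPolynomial σ K, (fun k => eval (v k) p) = Pi.single j 1 := by
  have hsep : ∀ k, ∃ p : MvPolynomial σ K, eval (v j) p = 1 ∧ (k ≠ j → eval (v k) p = 0) := by
    intro k
    rcases eq_or_ne k j with rfl | hk
    · exact ⟨1, by simp⟩
    · obtain ⟨i, hi⟩ := Function.ne_iff.1 (hv.ne hk.symm)
      refine ⟨C (v j i - v k i)⁻¹ * (X i - C (v k i)), ?_, fun _ => by simp⟩
      simpa using inv_mul_cancel₀ (sub_ne_zero.2 hi)
  choose p hp1 hp0 using hsep
  refine ⟨∏ k, p k, ?_⟩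
  ext l
  rcases eq_or_ne l j with rfl | hl
  · simp [hp1]
  · rw [map_prod, Pi.single_eq_of_ne hl]
    exact Finset.prod_eq_zero (Finset.mem_univ l) (hp0 l hl)

theorem eval_mem_span_monomials {K ι : Type*} [Field K] [Fintype σ] {m : ℕ} (v : ι → σ → K)
    (q : σ → MvPolynomial σ K) (hq : ∀ i, (q i).totalDegree < m)
    (hv : ∀ j i, v j i ^ m = eval (v j) (q i)) (p : MvPolynomial σ K) :
    (fun j => eval (v j) p) ∈
      Submodule.span K (Set.range fun (a : σ → Fin m) (j : ι) => ∏ i, v j i ^ (a i : ℕ)) := by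
  classical
  induction hn : p.totalDegree using Nat.strong_induction_on generalizing p with
  | _ n ih =>
    subst hn
    have hp : (fun j => eval (v j) p) =
        ∑ s ∈ p.support, coeff s p • fun j => ∏ i, v j i ^ s i := by
      ext j
      simp [eval_eq']
    rw [hp]
    refine Submodule.sum_mem _ fun s hs => Submodule.smul_mem _ _ ?_
    by_cases hsm : ∀ i, s i < m
    · exact Submodule.subset_span ⟨fun i => ⟨s i, hsm i⟩, rfl⟩
    · push Not at hsm
      obtain ⟨i, hi⟩ := hsm
      have hle : Finsupp.single i m ≤ s := by simpa using hi
      have hdeg := le_totalDegree hs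
      set r := s - Finsupp.single i m with hr
      have hsr : s = r + Finsupp.single i m := (tsub_add_cancel_of_le hle).symm
      have hsum : (s.sum fun _ e => e) = (r.sum fun _ e => e) + m := by
        rw [hsr, Finsupp.sum_add_index' (fun _ => rfl) (fun _ _ _ => rfl),
          Finsupp.sum_single_index rfl]
      have heq : (fun j => ∏ l, v j l ^ s l) = fun j => eval (v j) (monomial r 1 * q i) := by
        ext j
        rw [map_mul, eval_monomial, ← hv j i, one_mul, Finsupp.prod_fintype _ _ (by simp), hsr]
        simp only [Finsupp.add_apply, pow_add, Finset.prod_mul_distrib]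
        congr 1
        rw [Finset.prod_eq_single i (fun b _ hb => by simp [hb.symm]) (by simp)]
        simp
      rw [heq]
      refine ih _ ?_ _ rfl
      have h1 := totalDegree_mul (monomial r (1 : K)) (q i)
      rw [totalDegree_monomial _ one_ne_zero] at h1
      have := hq i
      omega

theorem card_le_pow_of_pow_eq_eval {K ι : Type*} [Field K] [Fintype σ] [Fintype ι] {m : ℕ}
    {v : ι → σ → K} (hinj : Function.Injective v)
    (q : σ → MvPolynomial σ K) (hq : ∀ i, (q i).totalDegree < m)
    (hv : ∀ j i, v j i ^ m = eval (v j) (q i)) :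
    Fintype.card ι ≤ m ^ Fintype.card σ := by
  classical
  set b : (σ → Fin m) → ι → K := fun a j => ∏ i, v j i ^ (a i : ℕ)
  have htop : Submodule.span K (Set.range b) = ⊤ := by
    rw [eq_top_iff, ← (Pi.basisFun K ι).span_eq, Submodule.span_le]
    rintro _ ⟨j, rfl⟩
    obtain ⟨p, hp⟩ := exists_eval_eq_pi_single hinj j
    rw [Pi.basisFun_apply, ← hp]
    exact eval_mem_span_monomials v q hq hv p
  have h := finrank_range_le_card (R := K) b
  rw [Set.finrank, htop, finrank_top, Module.finrank_fintype_fun_eq_card] at h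
  simpa using h

end MvPolynomial

theorem IsOpen.closure_connectedComponentIn_inter_subset {X : Type*} [TopologicalSpace X]
    [LocallyConnectedSpace X] {F : Set X} (hF : IsOpen F) (x : X) :
    closure (connectedComponentIn F x) ∩ F ⊆ connectedComponentIn F x := by
  rintro y ⟨hy, hyF⟩
  obtain ⟨z, hz, hz'⟩ := mem_closure_iff.1 hy _ hF.connectedComponentIn
    (mem_connectedComponentIn hyF)
  rw [connectedComponentIn_eq hz', ← connectedComponentIn_eq hz]
  exact mem_connectedComponentIn hyF

namespace MvPolynomial

variable {σ : Type*} [Fintype σ]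

theorem norm_pow_le_sum_pow {x : σ → ℝ} {n : ℕ} (hn : Even n) (hx : 0 < ‖x‖) :
    ‖x‖ ^ n ≤ ∑ i, x i ^ n := by
  have hne : Nonempty σ := by
    by_contra h
    rw [not_nonempty_iff] at h
    simp [Subsingleton.elim x 0] at hx
  obtain ⟨i, hi⟩ := Finite.exists_max fun i => ‖x i‖
  have h1 : ‖x‖ ≤ ‖x i‖ := (pi_norm_le_iff_of_nonneg (norm_nonneg _)).2 hi
  calc ‖x‖ ^ n ≤ ‖x i‖ ^ n := pow_le_pow_left₀ hx.le h1 n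
    _ = x i ^ n := by rw [Real.norm_eq_abs, hn.pow_abs]
    _ ≤ ∑ i, x i ^ n :=
      Finset.single_le_sum (f := fun i => x i ^ n) (fun j _ => hn.pow_nonneg _) (Finset.mem_univ i)

/-- Subtracting `ε ∑ xᵢⁿ` from `g`, with `n` even and larger than the degree of `g`, produces a
function that tends to `-∞`; it attains an interior maximum on each component of `g ≠ 0` on which
it takes a positive value. -/
theorem exists_critical_point_mem_component (g : MvPolynomial σ ℝ) {n : ℕ} (hn : Even n)
    (hg : g.totalDegree < n) {ε : ℝ} (hε : 0 < ε) {x₀ : σ → ℝ}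
    (hx₀ : 0 < eval x₀ g - ε * ∑ i, x₀ i ^ n) :
    ∃ x ∈ connectedComponentIn {y | eval y g ≠ 0} x₀,
      ∀ i, eval x (pderiv i g) = ε * n * x i ^ (n - 1) := by
  classical
  set F : Set (σ → ℝ) := {y | eval y g ≠ 0} with hFdef
  set h : (σ → ℝ) → ℝ := fun y => eval y g - ε * ∑ i, y i ^ n with hh
  have hcg : Continuous fun y => eval y g := continuous_eval g
  have hch : Continuous h := by fun_prop
  have hF : IsOpen F := isOpen_ne_fun hcg continuous_const
  have hS : ∀ y : σ → ℝ, 0 ≤ ε * ∑ i, y i ^ n := fun y =>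
    mul_nonneg hε.le (Finset.sum_nonneg fun _ _ => hn.pow_nonneg _)
  obtain ⟨A, hA, hbd⟩ := exists_abs_eval_le g (Nat.le_sub_one_of_lt hg)
  have hbounded : ∀ y, 0 < h y → ‖y‖ ≤ max 1 (A / ε) := by
    intro y hy
    by_contra! hlt
    obtain ⟨h1, h2⟩ := max_lt_iff.1 hlt
    have h3 := (le_abs_self _).trans (hbd y)
    rw [max_eq_right h1.le] at h3
    have h4 := norm_pow_le_sum_pow hn (by linarith : 0 < ‖y‖)
    have h5 : A ≤ ε * ‖y‖ := by
      rw [div_lt_iff₀ hε] at h2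
      linarith
    have h6 : A * ‖y‖ ^ (n - 1) ≤ ε * ‖y‖ ^ n := by
      obtain ⟨k, rfl⟩ : ∃ k, n = k + 1 := ⟨n - 1, by omega⟩
      rw [Nat.add_sub_cancel, pow_succ, mul_comm (_ ^ k), ← mul_assoc]
      exact mul_le_mul_of_nonneg_right h5 (by positivity)
    have h7 := mul_le_mul_of_nonneg_left h4 hε.le
    simp only [hh] at hy
    linarith
  have hx₀F : x₀ ∈ F := fun h0 => by
    have := hS x₀
    rw [h0] at hx₀
    linarith
  have hx₀K : x₀ ∈ closure (connectedComponentIn F x₀) ∩ Metric.closedBall 0 (max 1 (A / ε)) :=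
    ⟨subset_closure (mem_connectedComponentIn hx₀F), mem_closedBall_zero_iff.2 (hbounded x₀ hx₀)⟩
  obtain ⟨x, ⟨hxU, -⟩, hmax⟩ :=
    ((isCompact_closedBall (0 : σ → ℝ) (max 1 (A / ε))).inter_left
      (isClosed_closure (s := connectedComponentIn F x₀))).exists_isMaxOn
      ⟨x₀, hx₀K⟩ hch.continuousOn
  have hxpos : 0 < h x := lt_of_lt_of_le hx₀ (hmax hx₀K)
  have hxF : x ∈ F := fun h0 => by
    have := hS x
    simp only [hh, h0] at hxpos
    linarith
  have hx := hF.closure_connectedComponentIn_inter_subset x₀ ⟨hxU, hxF⟩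
  have hloc : IsLocalMax h x := by
    filter_upwards [hF.connectedComponentIn.mem_nhds hx] with y hy
    by_cases hyp : 0 < h y
    · exact hmax ⟨subset_closure hy, mem_closedBall_zero_iff.2 (hbounded y hyp)⟩
    · linarith
  refine ⟨x, hx, fun i => ?_⟩
  set P : MvPolynomial σ ℝ := g - C ε * ∑ j, X j ^ n with hP
  have hPh : ∀ y, eval y P = h y := fun y => by simp [hP, hh]
  have hd := hasDerivAt_eval_update P x i (x i)
  have hl : IsLocalMax (fun s => eval (Function.update x i s) P) (x i) := by
    simp only [hPh]
    have hc : ContinuousAt (fun s => Function.update x i s) (x i) := by fun_prop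
    have hl' : IsLocalMax h (Function.update x i (x i)) := by rwa [Function.update_eq_self]
    exact hl'.comp_continuous hc
  have hz := hl.hasDerivAt_eq_zero hd
  rw [Function.update_eq_self] at hz
  have hsum : pderiv i (∑ j, X j ^ n : MvPolynomial σ ℝ) = C (n : ℝ) * X i ^ (n - 1) := by
    rw [map_sum, Finset.sum_eq_single i]
    · simp
    · intro j _ hj
      simp [pderiv_X_of_ne hj]
    · simp
  rw [hP, map_sub, pderiv_C_mul, hsum] at hz
  simp only [map_sub, map_mul, eval_C, map_pow, eval_X] at hz
  linarith

theorem card_finset_components_le (f : MvPolynomial σ ℝ) {D : ℕ} (hf : f.totalDegree ≤ D)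
    (T : Finset (ConnectedComponents ({y | eval y f ≠ 0} : Set (σ → ℝ)))) :
    T.card ≤ (2 * D + 1) ^ Fintype.card σ := by
  classical
  revert T
  set F : Set (σ → ℝ) := {y | eval y f ≠ 0} with hF
  intro T
  set n := 2 * D + 2 with hn
  have hne : Even n := ⟨D + 1, by omega⟩
  have hdeg : (f ^ 2).totalDegree < n := (totalDegree_pow f 2).trans_lt (by omega)
  have hF2 : {y | eval y (f ^ 2) ≠ 0} = F := by
    ext y
    simp [hF]
  choose p hp using ConnectedComponents.surjective_coe (α := F)
  obtain ⟨ε, hε, hεT⟩ : ∃ ε : ℝ, 0 < ε ∧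
      ∀ c ∈ T, 0 < eval (p c : σ → ℝ) (f ^ 2) - ε * ∑ i, (p c : σ → ℝ) i ^ n := by
    have hev : ∀ c ∈ T, ∀ᶠ ε in nhdsWithin (0 : ℝ) (Set.Ioi 0),
        0 < eval (p c : σ → ℝ) (f ^ 2) - ε * ∑ i, (p c : σ → ℝ) i ^ n := by
      intro c _
      have hcont : Continuous fun ε : ℝ =>
          eval (p c : σ → ℝ) (f ^ 2) - ε * ∑ i, (p c : σ → ℝ) i ^ n := by fun_prop
      refine (hcont.tendsto 0).eventually_const_lt ?_ |>.filter_mono nhdsWithin_le_nhds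
      have hpc : eval (p c : σ → ℝ) f ≠ 0 := (p c).2
      rw [zero_mul, sub_zero, map_pow]
      positivity
    obtain ⟨ε, h1, h2⟩ :=
      (((Filter.eventually_all_finset T).2 hev).and self_mem_nhdsWithin).exists
    exact ⟨ε, h2, h1⟩
  have hcrit : ∀ c : T, ∃ x ∈ connectedComponentIn F (p c),
      ∀ i, eval x (pderiv i (f ^ 2)) = ε * n * x i ^ (n - 1) := by
    intro c
    have h := exists_critical_point_mem_component (f ^ 2) hne hdeg hε (hεT c c.2)
    rwa [hF2] at h
  choose v hvmem hv using hcrit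
  have hinj : Function.Injective v := by
    have key : ∀ c : T, ∀ hx : v c ∈ F, ((⟨v c, hx⟩ : F) : ConnectedComponents F) = c := by
      intro c hx
      have h := hvmem c
      rw [connectedComponentIn_eq_image (p c).2] at h
      obtain ⟨z, hz, hzv⟩ := h
      have hzc : (⟨v c, hx⟩ : F) = z := Subtype.ext hzv.symm
      rw [hzc, ← hp c]
      exact ConnectedComponents.coe_eq_coe'.2 hz
    intro c c' hcc
    have h1 := key c (connectedComponentIn_subset _ _ (hvmem c))
    have h2 := key c' (connectedComponentIn_subset _ _ (hvmem c'))
    exact Subtype.ext (by rw [← h1, ← h2]; simp only [hcc])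
  have hεn : ε * n ≠ 0 := by positivity
  have h := card_le_pow_of_pow_eq_eval (m := 2 * D + 1) hinj
    (fun i => C (ε * n)⁻¹ * pderiv i (f ^ 2))
    (fun i => by
      have h1 := totalDegree_mul (C (ε * n)⁻¹) (pderiv i (f ^ 2))
      have h2 := totalDegree_pderiv_le (f ^ 2) i
      have h3 := totalDegree_pow f 2
      rw [totalDegree_C] at h1
      omega)
    (fun c i => by
      rw [map_mul, eval_C, hv c i, inv_mul_cancel_left₀ hεn]
      rfl)
  simpa using h

end MvPolynomial

theorem finite_and_card_le_of_forall_finset {α : Type*} {N : ℕ}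
    (h : ∀ T : Finset α, T.card ≤ N) : Finite α ∧ Nat.card α ≤ N := by
  have hfin : Finite α := by
    by_contra hinf
    rw [not_finite_iff_infinite] at hinf
    obtain ⟨T, hT⟩ := Infinite.exists_subset_card_eq α (N + 1)
    have := h T
    omega
  refine ⟨hfin, ?_⟩
  have := Fintype.ofFinite α
  rw [Nat.card_eq_fintype_card]
  exact h Finset.univ

/-- There is an absolute constant `C` such that for every nonzero
polynomial `f ∈ ℝ[x,y,z]` of degree at most `D` (with `D ≥ 1`), the complement
`ℝ³ \ Z(f)` has finitely many connected components, and their number is at most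
`C·D³`. -/
theorem card_components_complement_le :
    ∃ C : ℕ, 0 < C ∧
      ∀ (D : ℕ), 1 ≤ D →
        ∀ f : MvPolynomial (Fin 3) ℝ, f ≠ 0 → f.totalDegree ≤ D →
          Finite (ConnectedComponents ((ZeroSet f)ᶜ : Set (Fin 3 → ℝ))) ∧
          Nat.card (ConnectedComponents ((ZeroSet f)ᶜ : Set (Fin 3 → ℝ))) ≤ C * D ^ 3 := by
  refine ⟨27, by norm_num, fun D hD f _ hf => finite_and_card_le_of_forall_finset fun T => ?_⟩
  have h := MvPolynomial.card_finset_components_le f hf T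
  rw [Fintype.card_fin] at h
  calc T.card ≤ (2 * D + 1) ^ 3 := h
    _ ≤ (3 * D) ^ 3 := Nat.pow_le_pow_left (by omega) 3
    _ = 27 * D ^ 3 := by ring
end
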